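/- Let A be a complex n×n matrix with AᵀA = I (a complex orthogonal matrix). Then for every P ∈ ℂ[x₁,…,xₙ], ∫_{ℝⁿ} P(A·x) dγₙ(x) = ∫_{ℝⁿ} P(x) dγₙ(x), where for x ∈ ℝⁿ, A·x denotes the vector in ℂⁿ with k-th coordinate Σⱼ A_{kj} xⱼ, and P(A·x) is the evaluation of P at this complex point. -/

import Mathlib

open MeasureTheory ProbabilityTheory

lemma integrable_pow_gaussianReal (k : ℕ) :
    Integrable (fun x : ℝ => x ^ k) (gaussianReal 0 1) :=
  integrable_pow_of_mem_interior_integrableExpSet (X := id)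
    (by simp [integrableExpSet_id_gaussianReal]) k

lemma integrable_gaussianPDFReal_mul_pow (k : ℕ) :
    Integrable (fun x : ℝ => gaussianPDFReal 0 1 x * x ^ k) := by
  have h := integrable_pow_gaussianReal k
  rw [gaussianReal_of_var_ne_zero _ one_ne_zero,
    integrable_withDensity_iff_integrable_smul' (measurable_gaussianPDF _ _)
      (Filter.Eventually.of_forall fun _ => gaussianPDF_lt_top)] at h
  simpa [toReal_gaussianPDF] using h

lemma hasDerivAt_gaussianPDFReal (x : ℝ) :
    HasDerivAt (gaussianPDFReal 0 1) (-(gaussianPDFReal 0 1 x * x)) x := by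
  have h := (((hasDerivAt_id x).pow 2).neg.div_const 2).exp.const_mul (Real.sqrt (2 * Real.pi))⁻¹
  have hf : gaussianPDFReal 0 1 =
      fun y => (Real.sqrt (2 * Real.pi))⁻¹ * Real.exp (-(id y ^ 2) / 2) := by
    ext y
    simp [gaussianPDFReal]
  rw [hf]
  convert! h using 1
  simp
  ring

/-- The moments of the standard Gaussian satisfy `m (k + 1) = k * m (k - 1)`. -/
lemma integral_pow_succ_gaussianReal (k : ℕ) :
    ∫ x, x ^ (k + 1) ∂(gaussianReal 0 1) = k * ∫ x, x ^ (k - 1) ∂(gaussianReal 0 1) := by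
  have hd (x : ℝ) : HasDerivAt (fun x : ℝ => gaussianPDFReal 0 1 x * x ^ k)
      (k * (gaussianPDFReal 0 1 x * x ^ (k - 1)) - gaussianPDFReal 0 1 x * x ^ (k + 1)) x := by
    convert! (hasDerivAt_gaussianPDFReal x).mul (hasDerivAt_pow k x) using 1
    ring
  have h₁ := (integrable_gaussianPDFReal_mul_pow (k - 1)).const_mul (k : ℝ)
  have h₂ := integrable_gaussianPDFReal_mul_pow (k + 1)
  have h := integral_eq_zero_of_hasDerivAt_of_integrable hd (h₁.sub h₂)
    (integrable_gaussianPDFReal_mul_pow k)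
  rw [integral_sub h₁ h₂, integral_const_mul] at h
  simp only [integral_gaussianReal_eq_integral_smul one_ne_zero, smul_eq_mul]
  linarith

namespace MvPolynomial

lemma pderiv_bind₁_linear {σ R : Type*} [Fintype σ] [CommRing R]
    (A : Matrix σ σ R) (j : σ) (p : MvPolynomial σ R) :
    pderiv j (bind₁ (fun k => ∑ i, C (A k i) * X i) p) =
      ∑ m, C (A m j) * bind₁ (fun k => ∑ i, C (A k i) * X i) (pderiv m p) := by
  classical
  induction p using MvPolynomial.induction_on with
  | C a => simp
  | add p q hp hq => simp [hp, hq, mul_add, Finset.sum_add_distrib]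
  | mul_X p k hp =>
    simp only [map_mul, bind₁_X_right, pderiv_mul, hp, map_add, map_sum, pderiv_C, pderiv_X,
      Pi.single_apply, mul_add, Finset.sum_add_distrib, Finset.sum_mul]
    congr 1
    · simp only [mul_assoc]
    · simp [apply_ite, mul_comm]

/-- A functional with `D (xᵢ p) = D (∂ᵢ p)` and `D 1 = 0` vanishes. -/
lemma eq_zero_of_apply_X_mul_eq_apply_pderiv {σ R : Type*} [Finite σ] [CommRing R]
    (D : MvPolynomial σ R →ₗ[R] R) (h1 : D 1 = 0)
    (hD : ∀ i p, D (X i * p) = D (pderiv i p)) : D = 0 := by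
  have key (s : σ →₀ ℕ) : ∀ c, D (monomial s c) = 0 := by
    induction s using WellFoundedLT.induction with
    | ind s ih =>
      intro c
      by_cases hs : s = 0
      · rw [hs, show monomial (0 : σ →₀ ℕ) c = c • 1 by simp [smul_eq_C_mul], map_smul, h1,
          smul_zero]
      · obtain ⟨i, hi⟩ := Finsupp.ne_iff.mp hs
        have hle : Finsupp.single i 1 ≤ s := by
          simpa [Nat.one_le_iff_ne_zero] using hi
        have hX : monomial s c = X i * monomial (s - Finsupp.single i 1) c := by
          rw [X, monomial_mul, one_mul, add_tsub_cancel_of_le hle]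
        rw [hX, hD, pderiv_monomial]
        refine ih _ (lt_of_le_of_lt tsub_le_self (lt_of_le_of_ne tsub_le_self fun he => ?_)) _
        have := DFunLike.congr_fun he i
        simp at this hi
        omega
  refine LinearMap.ext fun p => ?_
  induction p using MvPolynomial.induction_on' with
  | monomial s c => simpa using key s c
  | add p q hp hq => simp [hp, hq]

end MvPolynomial

open MvPolynomial

lemma eval_ofReal_monomial {n : ℕ} (s : Fin n →₀ ℕ) (c : ℂ) (x : Fin n → ℝ) :
    eval (fun i => (x i : ℂ)) (monomial s c) = c * ∏ i, (x i : ℂ) ^ s i := by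
  rw [eval_monomial, Finsupp.prod_fintype _ _ (by simp)]

lemma integrable_eval_gaussian {n : ℕ} (p : MvPolynomial (Fin n) ℂ) :
    Integrable (fun x : Fin n → ℝ => eval (fun i => (x i : ℂ)) p)
      (Measure.pi fun _ : Fin n => gaussianReal 0 1) := by
  induction p using MvPolynomial.induction_on' with
  | monomial s c =>
    simp only [eval_ofReal_monomial]
    refine (Integrable.fintype_prod (f := fun i (x : ℝ) => (x : ℂ) ^ s i) fun i => ?_).const_mul c
    simpa using (integrable_pow_gaussianReal (s i)).ofReal (𝕜 := ℂ)
  | add p q hp hq => simpa only [map_add] using! hp.add hq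

/-- The standard Gaussian expectation as a linear functional on complex polynomials. -/
noncomputable def gaussianExpectation (n : ℕ) : MvPolynomial (Fin n) ℂ →ₗ[ℂ] ℂ where
  toFun p := ∫ x : Fin n → ℝ, eval (fun i => (x i : ℂ)) p
    ∂(Measure.pi fun _ : Fin n => gaussianReal 0 1)
  map_add' p q := by
    simp only [map_add]
    exact integral_add (integrable_eval_gaussian p) (integrable_eval_gaussian q)
  map_smul' c p := by
    simp only [smul_eval, RingHom.id_apply, smul_eq_mul]
    exact integral_const_mul _ _

lemma gaussianExpectation_one (n : ℕ) : gaussianExpectation n 1 = 1 := by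
  simp [gaussianExpectation]

lemma gaussianExpectation_monomial {n : ℕ} (s : Fin n →₀ ℕ) (c : ℂ) :
    gaussianExpectation n (monomial s c) =
      c * ∏ i, ((∫ x, x ^ s i ∂(gaussianReal 0 1) : ℝ) : ℂ) := by
  simp only [gaussianExpectation, LinearMap.coe_mk, AddHom.coe_mk, eval_ofReal_monomial]
  rw [integral_const_mul, integral_fintype_prod_eq_prod (fun i (x : ℝ) => (x : ℂ) ^ s i)]
  simp only [← integral_complex_ofReal, Complex.ofReal_pow]

/-- Gaussian integration by parts for polynomials. -/
lemma gaussianExpectation_X_mul {n : ℕ} (i : Fin n) (p : MvPolynomial (Fin n) ℂ) :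
    gaussianExpectation n (X i * p) = gaussianExpectation n (pderiv i p) := by
  induction p using MvPolynomial.induction_on' with
  | add p q hp hq => simp only [mul_add, map_add, hp, hq]
  | monomial s c =>
    rw [X, monomial_mul, one_mul, pderiv_monomial, gaussianExpectation_monomial,
      gaussianExpectation_monomial, Fintype.prod_eq_mul_prod_compl i,
      Fintype.prod_eq_mul_prod_compl i]
    have hne : ∀ j ∈ ({i}ᶜ : Finset (Fin n)), j ≠ i := by simp
    have hprod :
        ∏ j ∈ {i}ᶜ, ((∫ x, x ^ (Finsupp.single i 1 + s : Fin n →₀ ℕ) j ∂(gaussianReal 0 1) : ℝ) : ℂ) =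
        ∏ j ∈ {i}ᶜ,
          ((∫ x, x ^ (s - Finsupp.single i 1 : Fin n →₀ ℕ) j ∂(gaussianReal 0 1) : ℝ) : ℂ) :=
      Finset.prod_congr rfl fun j hj => by
        rw [Finsupp.add_apply, Finsupp.tsub_apply, Finsupp.single_eq_of_ne (hne j hj), zero_add,
          tsub_zero]
    rw [hprod, Finsupp.add_apply, Finsupp.tsub_apply, Finsupp.single_eq_same, add_comm 1,
      integral_pow_succ_gaussianReal]
    push_cast
    ring

/-- the standard Gaussian expectation is invariant under complex
orthogonal changes of variables: if `AᵀA = I` then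
`∫ P(Ax) dγₙ(x) = ∫ P(x) dγₙ(x)` for every `P ∈ ℂ[x₁,…,xₙ]`. -/
theorem gaussian_orthogonal_invariance (n : ℕ) (A : Matrix (Fin n) (Fin n) ℂ)
    (hA : A.transpose * A = 1) (P : MvPolynomial (Fin n) ℂ) :
    (∫ x : Fin n → ℝ,
        MvPolynomial.eval (fun k => ∑ j : Fin n, A k j * (x j : ℂ)) P
      ∂(Measure.pi fun _ : Fin n => gaussianReal 0 1)) =
    (∫ x : Fin n → ℝ, MvPolynomial.eval (fun i => (x i : ℂ)) P
      ∂(Measure.pi fun _ : Fin n => gaussianReal 0 1)) := by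
  let T : MvPolynomial (Fin n) ℂ →ₐ[ℂ] MvPolynomial (Fin n) ℂ :=
    bind₁ (fun k => ∑ i, C (A k i) * X i)
  have hTX (k : Fin n) : T (X k) = ∑ i, C (A k i) * X i := bind₁_X_right _ k
  have hTd (j : Fin n) (p : MvPolynomial (Fin n) ℂ) :
      pderiv j (T p) = ∑ m, C (A m j) * T (pderiv m p) := pderiv_bind₁_linear A j p
  have hA' : A * A.transpose = 1 := mul_eq_one_comm.mp hA
  have hstein (k : Fin n) (p : MvPolynomial (Fin n) ℂ) :
      gaussianExpectation n (T (X k * p)) = gaussianExpectation n (T (pderiv k p)) := by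
    calc gaussianExpectation n (T (X k * p))
        = ∑ j, A k j * gaussianExpectation n (X j * T p) := by
          simp only [map_mul, hTX, Finset.sum_mul, mul_assoc]
          simp only [C_mul', map_sum, map_smul, smul_eq_mul]
      _ = ∑ j, ∑ m, A k j * (A m j * gaussianExpectation n (T (pderiv m p))) := by
          simp only [gaussianExpectation_X_mul, hTd, C_mul', map_sum, map_smul, smul_eq_mul,
            Finset.mul_sum]
      _ = ∑ m, (A * A.transpose) k m * gaussianExpectation n (T (pderiv m p)) := by
          rw [Finset.sum_comm]
          simp [Matrix.mul_apply, Finset.sum_mul, mul_assoc]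
      _ = gaussianExpectation n (T (pderiv k p)) := by
          simp [hA', Matrix.one_apply]
  have h0 := eq_zero_of_apply_X_mul_eq_apply_pderiv
    (gaussianExpectation n ∘ₗ T.toLinearMap - gaussianExpectation n) (by simp)
    (fun i p => by
      simpa [gaussianExpectation_X_mul, -map_mul] using hstein i p)
  have h := sub_eq_zero.mp (LinearMap.congr_fun h0 P)
  have heval (x : Fin n → ℝ) : eval (fun i => (x i : ℂ)) (T P) =
      eval (fun k => ∑ j : Fin n, A k j * (x j : ℂ)) P := by
    refine (eval₂Hom_bind₁ (RingHom.id ℂ) (fun i => (x i : ℂ))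
      (fun k => ∑ i, C (A k i) * X i) P).trans ?_
    simp only [coe_eval₂Hom, map_sum, map_mul, eval₂_C, eval₂_X, RingHom.id_apply]
    rfl
  simpa [gaussianExpectation, heval] using h
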